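/- For any n ≥ 1, Σ_{σ ∈ S_n(312)} q^{mad(σ)} = Σ_{σ ∈ S_n(132)} q^{FOZE7(σ)}, where FOZE7 = (1-32) + 2·(2-31) + des. -/

import Mathlib

namespace MahonianStats

open Finset

/-- The value sequence of a permutation of `{1,…,n}`: position `i` (0-indexed)
carries the value `σ(i+1) ∈ {1,…,n}`; positions `≥ n` carry the junk value `0`. -/
def pf {n : ℕ} (σ : Equiv.Perm (Fin n)) : ℕ → ℕ :=
  fun i => if h : i < n then ((σ ⟨i, h⟩ : Fin n) : ℕ) + 1 else 0

/-- The value sequence of a list (junk value `0` out of range). -/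
def lf (l : List ℕ) : ℕ → ℕ := fun i => l.getD i 0

/-- Descent positions (0-indexed). -/
def desSet (n : ℕ) (f : ℕ → ℕ) : Finset ℕ :=
  (range (n - 1)).filter fun i => f (i + 1) < f i

def des (n : ℕ) (f : ℕ → ℕ) : ℕ := (desSet n f).card

/-- Major index: sum of (1-indexed) descent positions. -/
def maj (n : ℕ) (f : ℕ → ℕ) : ℕ := ∑ i ∈ desSet n f, (i + 1)

/-- Occurrences of the vincular pattern (1-32). -/
def p1_32 (n : ℕ) (f : ℕ → ℕ) : ℕ :=
  ((range n ×ˢ range n).filter fun p =>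
    p.1 < p.2 ∧ p.2 + 1 < n ∧ f p.1 < f (p.2 + 1) ∧ f (p.2 + 1) < f p.2).card

/-- Occurrences of the vincular pattern (31-2). -/
def p31_2 (n : ℕ) (f : ℕ → ℕ) : ℕ :=
  ((range n ×ˢ range n).filter fun p =>
    p.1 + 1 < p.2 ∧ f (p.1 + 1) < f p.2 ∧ f p.2 < f p.1).card

/-- Occurrences of the vincular pattern (32-1). -/
def p32_1 (n : ℕ) (f : ℕ → ℕ) : ℕ :=
  ((range n ×ˢ range n).filter fun p =>
    p.1 + 1 < p.2 ∧ f p.2 < f (p.1 + 1) ∧ f (p.1 + 1) < f p.1).card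

/-- Occurrences of the vincular pattern (21-3). -/
def p21_3 (n : ℕ) (f : ℕ → ℕ) : ℕ :=
  ((range n ×ˢ range n).filter fun p =>
    p.1 + 1 < p.2 ∧ f (p.1 + 1) < f p.1 ∧ f p.1 < f p.2).card

/-- Occurrences of the vincular pattern (3-21). -/
def p3_21 (n : ℕ) (f : ℕ → ℕ) : ℕ :=
  ((range n ×ˢ range n).filter fun p =>
    p.1 < p.2 ∧ p.2 + 1 < n ∧ f (p.2 + 1) < f p.2 ∧ f p.2 < f p.1).card

/-- Occurrences of the vincular pattern (13-2). -/
def p13_2 (n : ℕ) (f : ℕ → ℕ) : ℕ :=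
  ((range n ×ˢ range n).filter fun p =>
    p.1 + 1 < p.2 ∧ f p.1 < f p.2 ∧ f p.2 < f (p.1 + 1)).card

/-- Occurrences of the vincular pattern (2-13). -/
def p2_13 (n : ℕ) (f : ℕ → ℕ) : ℕ :=
  ((range n ×ˢ range n).filter fun p =>
    p.1 < p.2 ∧ p.2 + 1 < n ∧ f p.2 < f p.1 ∧ f p.1 < f (p.2 + 1)).card

/-- Occurrences of the vincular pattern (2-31). -/
def p2_31 (n : ℕ) (f : ℕ → ℕ) : ℕ :=
  ((range n ×ˢ range n).filter fun p =>
    p.1 < p.2 ∧ p.2 + 1 < n ∧ f (p.2 + 1) < f p.1 ∧ f p.1 < f p.2).card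

/-- Number of inversions. -/
def invp (n : ℕ) (f : ℕ → ℕ) : ℕ :=
  ((range n ×ˢ range n).filter fun p => p.1 < p.2 ∧ f p.2 < f p.1).card

def mak (n : ℕ) (f : ℕ → ℕ) : ℕ := p1_32 n f + p31_2 n f + p32_1 n f + des n f

def mad (n : ℕ) (f : ℕ → ℕ) : ℕ := 2 * p2_31 n f + p31_2 n f + des n f

def Av123 (n : ℕ) (f : ℕ → ℕ) : Prop :=
  ¬ ∃ i j k, i < j ∧ j < k ∧ k < n ∧ f i < f j ∧ f j < f k
def Av132 (n : ℕ) (f : ℕ → ℕ) : Prop :=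
  ¬ ∃ i j k, i < j ∧ j < k ∧ k < n ∧ f i < f k ∧ f k < f j
def Av213 (n : ℕ) (f : ℕ → ℕ) : Prop :=
  ¬ ∃ i j k, i < j ∧ j < k ∧ k < n ∧ f j < f i ∧ f i < f k
def Av231 (n : ℕ) (f : ℕ → ℕ) : Prop :=
  ¬ ∃ i j k, i < j ∧ j < k ∧ k < n ∧ f k < f i ∧ f i < f j
def Av312 (n : ℕ) (f : ℕ → ℕ) : Prop :=
  ¬ ∃ i j k, i < j ∧ j < k ∧ k < n ∧ f j < f k ∧ f k < f i
def Av321 (n : ℕ) (f : ℕ → ℕ) : Prop :=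
  ¬ ∃ i j k, i < j ∧ j < k ∧ k < n ∧ f k < f j ∧ f j < f i

/-- The Mahonian statistic `(1-32) + 2·(2-31) + des`. -/
def foze7 (n : ℕ) (f : ℕ → ℕ) : ℕ := p1_32 n f + 2 * p2_31 n f + des n f

/-- Plane binary trees. -/
inductive BT where
  | nil : BT
  | node : BT → BT → BT

def BT.size : BT → ℕ
  | .nil => 0
  | .node a b => a.size + b.size + 1

/-- Number of adjacent descents of the list straddling `x`. -/
def strad (x : ℕ) : List ℕ → ℕ
  | [] => 0
  | [_] => 0
  | a :: b :: l => (if b < x ∧ x < a then 1 else 0) + strad x (b :: l)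

def lP : List ℕ → ℕ
  | [] => 0
  | x :: l => strad x l + lP l

def lD : List ℕ → ℕ
  | [] => 0
  | [_] => 0
  | a :: b :: l => (if b < a then 1 else 0) + lD (b :: l)

lemma strad_cons2 (x a b : ℕ) (l : List ℕ) : strad x (a :: b :: l) =
    (if b < x ∧ x < a then 1 else 0) + strad x (b :: l) := rfl

lemma lP_cons (x : ℕ) (l : List ℕ) : lP (x :: l) = strad x l + lP l := rfl

lemma lD_cons2 (a b : ℕ) (l : List ℕ) : lD (a :: b :: l) =
    (if b < a then 1 else 0) + lD (b :: l) := rfl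

def lQ (l : List ℕ) : ℕ := 2 * lP l + lD l

lemma lf_succ (x : ℕ) (l : List ℕ) (i : ℕ) : lf (x :: l) (i + 1) = lf l i := by
  simp [lf]

lemma lf_zero (x : ℕ) (l : List ℕ) : lf (x :: l) 0 = x := by
  simp [lf]

lemma strad_eq (x : ℕ) (l : List ℕ) : strad x l =
    ∑ j ∈ range l.length, if j + 1 < l.length ∧ lf l (j + 1) < x ∧ x < lf l j then 1 else 0 := by
  induction l with
  | nil => simp [strad]
  | cons a l ih =>
    cases l with
    | nil => simp [strad]
    | cons b l =>
      rw [List.length_cons, Finset.sum_range_succ', strad, ih, add_comm]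
      simp [lf_succ, lf_zero]

lemma lP_eq (l : List ℕ) : p2_31 l.length (lf l) = lP l := by
  induction l with
  | nil => simp [lP, p2_31]
  | cons a l ih =>
    rw [lP, ← ih, strad_eq]
    unfold p2_31
    rw [Finset.card_filter, Finset.card_filter, Finset.sum_product, Finset.sum_product,
      List.length_cons, Finset.sum_range_succ', Finset.sum_range_succ', add_comm]
    simp only [Finset.sum_range_succ']
    simp [lf_succ, lf_zero]

lemma lD_eq (l : List ℕ) : des l.length (lf l) = lD l := by
  induction l with
  | nil => simp [lD, des, desSet]
  | cons a l ih =>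
    cases l with
    | nil => simp [lD, des, desSet]
    | cons b l =>
      rw [lD, ← ih]
      unfold des desSet
      rw [Finset.card_filter, Finset.card_filter]
      simp only [List.length_cons, Nat.add_sub_cancel]
      rw [Finset.sum_range_succ', add_comm]
      simp [lf_succ, lf_zero]

def L312 (l : List ℕ) : Prop := ∀ a b c, [a, b, c].Sublist l → ¬ (b < c ∧ c < a)
def L132 (l : List ℕ) : Prop := ∀ a b c, [a, b, c].Sublist l → ¬ (a < c ∧ c < b)

lemma sub1 (l : List ℕ) (a : ℕ) : [a].Sublist l ↔ ∃ i, i < l.length ∧ lf l i = a := by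
  rw [List.singleton_sublist, List.mem_iff_getElem]
  constructor
  · rintro ⟨i, h, rfl⟩
    exact ⟨i, h, by simp [lf, h]⟩
  · rintro ⟨i, h, rfl⟩
    exact ⟨i, h, by simp [lf, h]⟩

lemma sub2 (l : List ℕ) (a b : ℕ) : [a, b].Sublist l ↔
    ∃ i j, i < j ∧ j < l.length ∧ lf l i = a ∧ lf l j = b := by
  induction l with
  | nil => simp
  | cons x l ih =>
    rw [List.sublist_cons_iff, ih]
    constructor
    · rintro (⟨i, j, h1, h2, h3, h4⟩ | ⟨r, h, h'⟩)
      · exact ⟨i+1, j+1, by omega, by simpa using h2, by simpa [lf_succ], by simpa [lf_succ]⟩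
      · simp only [List.cons.injEq] at h
        obtain ⟨rfl, rfl⟩ := h
        obtain ⟨j, h1, h2⟩ := (sub1 _ _).1 h'
        exact ⟨0, j+1, by omega, by simpa using h1, by simp [lf_zero], by simpa [lf_succ]⟩
    · rintro ⟨i, j, h1, h2, h3, h4⟩
      obtain ⟨j, rfl⟩ : ∃ j', j = j' + 1 := ⟨j - 1, by omega⟩
      rw [lf_succ] at h4
      cases i with
      | zero =>
        right
        refine ⟨[b], ?_, (sub1 _ _).2 ⟨j, by simpa using h2, h4⟩⟩
        rw [lf_zero] at h3
        rw [h3]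
      | succ i =>
        left
        exact ⟨i, j, by omega, by simpa using h2, by simpa [lf_succ] using h3, h4⟩

lemma sub3 (l : List ℕ) (a b c : ℕ) : [a, b, c].Sublist l ↔
    ∃ i j k, i < j ∧ j < k ∧ k < l.length ∧ lf l i = a ∧ lf l j = b ∧ lf l k = c := by
  induction l with
  | nil => simp
  | cons x l ih =>
    rw [List.sublist_cons_iff, ih]
    constructor
    · rintro (⟨i, j, k, h1, h2, h3, h4, h5, h6⟩ | ⟨r, h, h'⟩)
      · exact ⟨i+1, j+1, k+1, by omega, by omega, by simpa using h3, by simpa [lf_succ],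
          by simpa [lf_succ], by simpa [lf_succ]⟩
      · simp only [List.cons.injEq] at h
        obtain ⟨rfl, rfl⟩ := h
        obtain ⟨j, k, h1, h2, h3, h4⟩ := (sub2 _ _ _).1 h'
        exact ⟨0, j+1, k+1, by omega, by omega, by simpa using h2, by simp [lf_zero],
          by simpa [lf_succ], by simpa [lf_succ]⟩
    · rintro ⟨i, j, k, h1, h2, h3, h4, h5, h6⟩
      obtain ⟨j, rfl⟩ : ∃ j', j = j' + 1 := ⟨j - 1, by omega⟩
      obtain ⟨k, rfl⟩ : ∃ j', k = j' + 1 := ⟨k - 1, by omega⟩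
      rw [lf_succ] at h5 h6
      cases i with
      | zero =>
        right
        refine ⟨[b, c], ?_, (sub2 _ _ _).2 ⟨j, k, by omega, by simpa using h3, h5, h6⟩⟩
        rw [lf_zero] at h4
        rw [h4]
      | succ i =>
        left
        exact ⟨i, j, k, by omega, by omega, by simpa using h3, by simpa [lf_succ] using h4, h5, h6⟩

lemma L312_iff (l : List ℕ) : Av312 l.length (lf l) ↔ L312 l := by
  unfold Av312 L312
  constructor
  · intro h a b c hs hh
    obtain ⟨i, j, k, h1, h2, h3, h4, h5, h6⟩ := (sub3 _ _ _ _).1 hs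
    subst h4 h5 h6
    exact h ⟨i, j, k, h1, h2, h3, hh⟩
  · rintro h ⟨i, j, k, h1, h2, h3, hh⟩
    exact h _ _ _ ((sub3 _ _ _ _).2 ⟨i, j, k, h1, h2, h3, rfl, rfl, rfl⟩) hh

lemma L132_iff (l : List ℕ) : Av132 l.length (lf l) ↔ L132 l := by
  unfold Av132 L132
  constructor
  · intro h a b c hs hh
    obtain ⟨i, j, k, h1, h2, h3, h4, h5, h6⟩ := (sub3 _ _ _ _).1 hs
    subst h4 h5 h6
    exact h ⟨i, j, k, h1, h2, h3, hh⟩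
  · rintro h ⟨i, j, k, h1, h2, h3, hh⟩
    exact h _ _ _ ((sub3 _ _ _ _).2 ⟨i, j, k, h1, h2, h3, rfl, rfl, rfl⟩) hh

lemma mad_eq (l : List ℕ) (h : Av312 l.length (lf l)) : mad l.length (lf l) = lQ l := by
  have : p31_2 l.length (lf l) = 0 := by
    unfold p31_2
    rw [Finset.card_eq_zero, Finset.filter_eq_empty_iff]
    rintro ⟨i, k⟩ hik ⟨h1, h2, h3⟩
    simp only [Finset.mem_product, Finset.mem_range] at hik h1 h2 h3
    exact h ⟨i, i+1, k, by omega, h1, hik.2, h2, h3⟩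
  rw [mad, this, lP_eq, lD_eq, lQ, add_zero]

lemma foze7_eq (l : List ℕ) (h : Av132 l.length (lf l)) : foze7 l.length (lf l) = lQ l := by
  have : p1_32 l.length (lf l) = 0 := by
    unfold p1_32
    rw [Finset.card_eq_zero, Finset.filter_eq_empty_iff]
    rintro ⟨i, k⟩ hik ⟨h1, h2, h3, h4⟩
    simp only [Finset.mem_product, Finset.mem_range] at hik h1 h2 h3 h4
    exact h ⟨i, k, k+1, by omega, by omega, h2, h3, h4⟩
  rw [foze7, this, lP_eq, lD_eq, lQ, zero_add]

/-- `l` lists exactly the interval `[s, e)`. -/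
def Lists (l : List ℕ) (s e : ℕ) : Prop := l.Nodup ∧ ∀ x, x ∈ l ↔ s ≤ x ∧ x < e

lemma Lists.len {l : List ℕ} {s e : ℕ} (h : Lists l s e) : l.length = e - s := by
  rw [← List.toFinset_card_of_nodup h.1, ← Nat.card_Ico]
  congr 1
  ext x
  simp [h.2]

/-- The word of a permutation. -/
def toL {n : ℕ} (σ : Equiv.Perm (Fin n)) : List ℕ := List.ofFn fun i => ((σ i : Fin n) : ℕ) + 1

lemma toL_length {n : ℕ} (σ : Equiv.Perm (Fin n)) : (toL σ).length = n := by simp [toL]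

lemma pf_eq {n : ℕ} (σ : Equiv.Perm (Fin n)) : pf σ = lf (toL σ) := by
  funext i
  unfold pf lf toL
  by_cases h : i < n <;> simp [h]

lemma toL_inj {n : ℕ} : Function.Injective (toL (n := n)) := by
  intro σ τ h
  have := List.ofFn_injective h
  ext i
  have := congrFun this i
  simpa using this

lemma toL_lists {n : ℕ} (σ : Equiv.Perm (Fin n)) : Lists (toL σ) 1 (n + 1) := by
  constructor
  · rw [toL, List.nodup_ofFn]
    intro i j h
    apply σ.injective
    ext
    simpa using h
  · intro x
    rw [toL, List.mem_ofFn]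
    constructor
    · rintro ⟨i, rfl⟩
      have := (σ i).2
      omega
    · rintro ⟨h1, h2⟩
      refine ⟨σ.symm ⟨x - 1, by omega⟩, ?_⟩
      simp
      omega

lemma toL_surj {n : ℕ} (l : List ℕ) (h : Lists l 1 (n + 1)) :
    ∃ σ : Equiv.Perm (Fin n), toL σ = l := by
  have hl : l.length = n := by simpa using h.len
  have hm : ∀ i : Fin n, 1 ≤ l[i]'(by omega) ∧ l[i]'(by omega) < n + 1 := fun i =>
    (h.2 _).1 (List.getElem_mem _)
  let f : Fin n → Fin n := fun i => ⟨l[i]'(by omega) - 1, by have := hm i; omega⟩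
  have hf : Function.Injective f := by
    intro i j hij
    have h1 := hm i
    have h2 := hm j
    simp only [f, Fin.mk.injEq] at hij
    have h3 : l[i]'(by omega) = l[j]'(by omega) := by omega
    ext
    exact (h.1.getElem_inj_iff).1 h3
  refine ⟨Equiv.ofBijective f (Finite.injective_iff_bijective.1 hf), ?_⟩
  apply List.ext_getElem
  · simp [toL, hl]
  · intro i h1 h2
    have := hm ⟨i, by omega⟩
    simp [toL, f] at this ⊢
    omega

/-- 312-avoiding word of a tree. -/
def W1 : BT → ℕ → List ℕ
  | .nil, _ => []
  | .node L M, s => W1 L s ++ (W1 M (s + L.size + 1) ++ [s + L.size])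

/-- 132-avoiding word of a tree. -/
def W2 : BT → ℕ → List ℕ
  | .nil, _ => []
  | .node L R, s => W2 L (s + R.size) ++ (s + L.size + R.size) :: W2 R s

def pen (M : BT) (c : ℕ) : ℕ :=
  match M with
  | .nil => 0
  | .node _ _ => 1 + 2 * c

def lsize : BT → ℕ
  | .nil => 0
  | .node a _ => a.size

def s1 : BT → ℕ
  | .nil => 0
  | .node L M => s1 L + s1 M + pen M (lsize M)

def s2 : BT → ℕ
  | .nil => 0
  | .node L R => s2 L + s2 R + pen R L.size

def psi : BT → BT
  | .nil => .nil
  | .node A B =>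
    match psi B with
    | .nil => .node (psi A) .nil
    | .node L M => .node L (.node (psi A) M)

lemma psi_size (t : BT) : (psi t).size = t.size := by
  induction t with
  | nil => rfl
  | node A B ihA ihB =>
    rw [psi]
    cases h : psi B <;> rw [h] at ihB <;> simp [BT.size] at * <;> omega

lemma psi_s (t : BT) : s1 (psi t) = s2 t := by
  induction t with
  | nil => rfl
  | node A B ihA ihB =>
    have hA := psi_size A
    have hB := psi_size B
    rw [psi]
    cases h : psi B <;> rw [h] at ihB hB <;> cases B <;>
      simp [BT.size, s1, s2, pen, lsize] at * <;> omega

lemma psi_inj : Function.Injective psi := by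
  intro t
  induction t with
  | nil =>
    intro u h
    have := congrArg BT.size h
    rw [psi_size, psi_size] at this
    cases u
    · rfl
    · simp [BT.size] at this
  | node A B ihA ihB =>
    intro u h
    cases u with
    | nil =>
      have := congrArg BT.size h
      rw [psi_size, psi_size] at this
      simp [BT.size] at this
    | node A' B' =>
      rw [psi, psi] at h
      cases h1 : psi B <;> cases h2 : psi B' <;> simp [h1, h2] at h
      · rw [ihA h, ihB (h1.trans h2.symm)]
      · rw [ihA h.2.1, ihB (h1.trans (by rw [h2, h.1, h.2.2]))]

lemma psi_surj (n : ℕ) : ∀ t : BT, t.size ≤ n → ∃ u, psi u = t := by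
  induction n with
  | zero =>
    intro t ht
    cases t with
    | nil => exact ⟨.nil, rfl⟩
    | node => simp [BT.size] at ht
  | succ n ih =>
    intro t ht
    match t with
    | .nil => exact ⟨.nil, rfl⟩
    | .node L .nil =>
      obtain ⟨u, hu⟩ := ih L (by simp [BT.size] at ht; omega)
      exact ⟨.node u .nil, by simp [psi, hu]⟩
    | .node L (.node L' M) =>
      obtain ⟨u, hu⟩ := ih L' (by simp [BT.size] at ht; omega)
      obtain ⟨v, hv⟩ := ih (.node L M) (by simp [BT.size] at ht ⊢; omega)
      exact ⟨.node u v, by simp [psi, hu, hv]⟩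

lemma W1_lists (t : BT) : ∀ s, Lists (W1 t s) s (s + t.size) := by
  induction t with
  | nil => intro s; simp [W1, Lists, BT.size]
  | node L M ihL ihM =>
    intro s
    have h1 := ihL s
    have h2 := ihM (s + L.size + 1)
    constructor
    · rw [W1, List.nodup_append, List.nodup_append]
      refine ⟨h1.1, ⟨h2.1, by simp, ?_⟩, ?_⟩
      · intro a ha b hb
        have := (h2.2 _).1 ha
        simp at hb
        omega
      · intro a ha b hb
        have := (h1.2 _).1 ha
        rw [List.mem_append, h2.2, List.mem_singleton] at hb
        omega
    · intro x
      rw [W1, List.mem_append, List.mem_append, h1.2, h2.2, List.mem_singleton, BT.size]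
      omega

lemma W2_lists (t : BT) : ∀ s, Lists (W2 t s) s (s + t.size) := by
  induction t with
  | nil => intro s; simp [W2, Lists, BT.size]
  | node L M ihL ihM =>
    intro s
    have h1 := ihL (s + M.size)
    have h2 := ihM s
    constructor
    · rw [W2, List.nodup_append, List.nodup_cons]
      refine ⟨h1.1, ⟨?_, h2.1⟩, ?_⟩
      · rw [h2.2]
        omega
      · intro a ha b hb
        have := (h1.2 _).1 ha
        rw [List.mem_cons, h2.2] at hb
        omega
    · intro x
      rw [W2, List.mem_append, List.mem_cons, h1.2, h2.2, BT.size]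
      omega

lemma W1_length (t : BT) (s : ℕ) : (W1 t s).length = t.size := by
  simpa using (W1_lists t s).len

lemma W2_length (t : BT) (s : ℕ) : (W2 t s).length = t.size := by
  simpa using (W2_lists t s).len

lemma W1_inj (t : BT) : ∀ s u, W1 t s = W1 u s → t = u := by
  induction t with
  | nil =>
    intro s u h
    have := congrArg List.length h
    rw [W1_length, W1_length] at this
    cases u
    · rfl
    · simp [BT.size] at this
  | node L M ihL ihM =>
    intro s u h
    cases u with
    | nil =>
      have := congrArg List.length h
      rw [W1_length, W1_length] at this
      simp [BT.size] at this
    | node L' M' =>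
      rw [W1, W1, ← List.append_assoc, ← List.append_assoc] at h
      obtain ⟨h1, h2⟩ := List.append_inj' h rfl
      have h3 : L.size = L'.size := by simpa using h2
      obtain ⟨h4, h5⟩ := List.append_inj h1 (by rw [W1_length, W1_length, h3])
      rw [← h3] at h5
      rw [ihL _ _ h4, ihM _ _ h5]

lemma split_unique (m : ℕ) (a b c d : List ℕ) (h : a ++ m :: b = c ++ m :: d)
    (ha : m ∉ a) (hc : m ∉ c) : a = c ∧ b = d := by
  induction a generalizing c with
  | nil =>
    cases c with
    | nil => simpa using h
    | cons x c => simp at h hc; exact absurd h.1 hc.1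
  | cons y a ih =>
    cases c with
    | nil => simp at h ha; exact absurd h.1.symm ha.1
    | cons x c =>
      simp at h ha hc
      obtain ⟨h1, h2⟩ := ih c h.2 ha.2 hc.2
      exact ⟨by rw [h.1, h1], h2⟩

lemma W2_inj (t : BT) : ∀ s u, W2 t s = W2 u s → t = u := by
  induction t with
  | nil =>
    intro s u h
    have := congrArg List.length h
    rw [W2_length, W2_length] at this
    cases u
    · rfl
    · simp [BT.size] at this
  | node L M ihL ihM =>
    intro s u h
    have h0 := congrArg List.length h
    rw [W2_length, W2_length] at h0
    cases u with
    | nil => simp [BT.size] at h0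
    | node L' M' =>
      simp only [BT.size] at h0
      have h1 : s + L'.size + M'.size = s + L.size + M.size := by omega
      rw [W2, W2, h1] at h
      obtain ⟨h4, h5⟩ := split_unique _ _ _ _ _ h
        (by rw [(W2_lists _ _).2]; omega) (by rw [(W2_lists _ _).2]; omega)
      have h6 := congrArg List.length h5
      rw [W2_length, W2_length] at h6
      rw [← h6] at h4
      rw [ihL _ _ h4, ihM _ _ h5]

lemma sub_app2 {a b : ℕ} {l r : List ℕ} (h : [a, b].Sublist (l ++ r)) :
    [a, b].Sublist l ∨ (a ∈ l ∧ b ∈ r) ∨ [a, b].Sublist r := by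
  rw [List.sublist_append_iff] at h
  obtain ⟨p, q, h1, h2, h3⟩ := h
  match p, h1, h2 with
  | [], h1, _ => simp at h1; subst h1; exact Or.inr (Or.inr h3)
  | [x], h1, h2 => 
    simp at h1; obtain ⟨rfl, rfl⟩ := h1; simp at h2 h3; exact Or.inr (Or.inl ⟨h2, h3⟩)
  | [x, y], h1, h2 => 
    simp at h1; obtain ⟨rfl, rfl, rfl⟩ := h1; exact Or.inl h2
  | x :: y :: z :: p, h1, h2 => simp at h1

lemma sub_app3 {a b c : ℕ} {l r : List ℕ} (h : [a, b, c].Sublist (l ++ r)) :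
    [a, b, c].Sublist l ∨ ([a, b].Sublist l ∧ c ∈ r) ∨ (a ∈ l ∧ [b, c].Sublist r) ∨
      [a, b, c].Sublist r := by
  rw [List.sublist_append_iff] at h
  obtain ⟨p, q, h1, h2, h3⟩ := h
  match p, h1, h2 with
  | [], h1, _ => simp at h1; subst h1; exact Or.inr (Or.inr (Or.inr h3))
  | [x], h1, h2 => 
    simp at h1; obtain ⟨rfl, rfl⟩ := h1; simp at h2; exact Or.inr (Or.inr (Or.inl ⟨h2, h3⟩))
  | [x, y], h1, h2 => 
    simp at h1; obtain ⟨rfl, rfl, rfl⟩ := h1; simp at h3; exact Or.inr (Or.inl ⟨h2, h3⟩)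
  | [x, y, z], h1, h2 => 
    simp at h1; obtain ⟨rfl, rfl, rfl, rfl⟩ := h1; exact Or.inl h2
  | x :: y :: z :: w :: p, h1, h2 => simp at h1

lemma sub2_mem {a b : ℕ} {l : List ℕ} (h : [a, b].Sublist l) : a ∈ l ∧ b ∈ l :=
  ⟨h.subset (by simp), h.subset (by simp)⟩

lemma sub3_mem {a b c : ℕ} {l : List ℕ} (h : [a, b, c].Sublist l) : a ∈ l ∧ b ∈ l ∧ c ∈ l :=
  ⟨h.subset (by simp), h.subset (by simp), h.subset (by simp)⟩

lemma W1_av (t : BT) : ∀ s, L312 (W1 t s) := by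
  induction t with
  | nil => intro s a b c h; simp [W1] at h
  | node L M ihL ihM =>
    intro s a b c h hh
    have hL := fun x => (W1_lists L s).2 x
    have hM := fun x => (W1_lists M (s + L.size + 1)).2 x
    rw [W1] at h
    rcases sub_app3 h with h | ⟨h, h'⟩ | ⟨h, h'⟩ | h
    · exact ihL s a b c h hh
    · have := (hL _).1 (sub2_mem h).1
      rw [List.mem_append, hM, List.mem_singleton] at h'
      omega
    · have := (hL _).1 h
      have h'' := (sub2_mem h').2
      rw [List.mem_append, hM, List.mem_singleton] at h''
      omega
    · rcases sub_app3 h with h | ⟨h, h'⟩ | ⟨h, h'⟩ | h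
      · exact ihM _ a b c h hh
      · have := (hM _).1 (sub2_mem h).2
        rw [List.mem_singleton] at h'
        omega
      · simpa using h'.length_le
      · simpa using h.length_le

lemma W2_av (t : BT) : ∀ s, L132 (W2 t s) := by
  induction t with
  | nil => intro s a b c h; simp [W2] at h
  | node L M ihL ihM =>
    intro s a b c h hh
    have hL := fun x => (W2_lists L (s + M.size)).2 x
    have hM := fun x => (W2_lists M s).2 x
    rw [W2] at h
    rcases sub_app3 h with h | ⟨h, h'⟩ | ⟨h, h'⟩ | h
    · exact ihL _ a b c h hh
    · have := (hL _).1 (sub2_mem h).1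
      have := (hL _).1 (sub2_mem h).2
      rw [List.mem_cons, hM] at h'
      omega
    · have := (hL _).1 h
      have h1 := (sub2_mem h').2
      have h2 := (sub2_mem h').1
      rw [List.mem_cons, hM] at h1 h2
      omega
    · rw [List.sublist_cons_iff] at h
      rcases h with h | ⟨r, h, h'⟩
      · exact ihM _ a b c h hh
      · simp only [List.cons.injEq] at h
        obtain ⟨rfl, rfl⟩ := h
        have := (hM _).1 (sub2_mem h').2
        omega

lemma W1_surj (n : ℕ) : ∀ l s, l.length ≤ n → Lists l s (s + l.length) → L312 l →
    ∃ t, W1 t s = l := by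
  induction n with
  | zero =>
    intro l s hn _ _
    exact ⟨.nil, by rw [W1]; exact (List.length_eq_zero_iff.1 (by omega)).symm⟩
  | succ n ih =>
    intro l s hn hl hav
    rcases List.eq_nil_or_concat l with rfl | ⟨l0, k, rfl⟩
    · exact ⟨.nil, rfl⟩
    obtain ⟨L, M, rfl, hL, hM⟩ : ∃ L M, l0 = L ++ M ∧ (∀ x ∈ L, x < k) ∧ (∀ x ∈ M, k < x) := by
      refine ⟨l0.takeWhile (· < k), l0.dropWhile (· < k), List.takeWhile_append_dropWhile.symm,
        ?_, ?_⟩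
      · intro x hx
        simpa using List.mem_takeWhile_imp hx
      · have hd := List.dropWhile_sublist (l := l0) (fun x => decide (x < k))
        have hhead := List.head?_dropWhile_not (fun x => decide (x < k)) l0
        have hk : k ∉ l0 := by
          intro hk
          have := hl.1
          simp [List.nodup_append] at this
          exact this.2 k hk rfl
        generalize l0.dropWhile (fun x => decide (x < k)) = M at hd hhead
        cases M with
        | nil => simp
        | cons h M =>
          simp at hhead
          intro x hx
          have hxk : x ≠ k := fun e => hk (e ▸ hd.subset hx)
          by_contra hlt
          rw [List.mem_cons] at hx
          rcases hx with rfl | hx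
          · omega
          · have hhk : h ≠ k := fun e => hk (e ▸ hd.subset (by simp))
            refine hav h x k ?_ ⟨by omega, by omega⟩
            have : [h, x].Sublist l0 :=
              List.Sublist.trans (by simpa using hx) hd
            simpa using this.append (List.Sublist.refl [k])
    have hnd := hl.1
    have hmem := hl.2
    simp only [List.concat_eq_append, List.append_assoc, List.nodup_append, List.mem_append,
      List.mem_singleton, List.length_append, List.length_singleton] at hnd hmem hn
    have hkm := (hmem k).1 (by simp)
    have hL' : Lists L s k := by
      refine ⟨hnd.1, fun x => ⟨fun hx => ⟨((hmem x).1 (by simp [hx])).1, hL x hx⟩, fun hx => ?_⟩⟩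
      rcases (hmem x).2 (by omega) with h | h | h
      · exact h
      · have := hM x h; omega
      · omega
    have hM' : Lists M (k + 1) (s + (L.length + (M.length + 1))) := by
      refine ⟨hnd.2.1.1, fun x => ⟨fun hx => ⟨hM x hx, ((hmem x).1 (by simp [hx])).2⟩,
        fun hx => ?_⟩⟩
      rcases (hmem x).2 (by omega) with h | h | h
      · have := hL x h; omega
      · exact h
      · omega
    have hlen := hL'.len
    have hk : k = s + L.length := by omega
    obtain ⟨t, ht⟩ := ih L s (by omega) (by rw [← hk]; exact hL')
      (fun a b c h => hav a b c (h.trans (by simp)))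
    obtain ⟨u, hu⟩ := ih M (k + 1) (by omega)
      (by convert hM' using 1; omega)
      (fun a b c h => hav a b c (h.trans (by
        simp only [List.concat_eq_append, List.append_assoc]
        exact (List.sublist_append_left M [k]).trans (List.sublist_append_right _ _))))
    refine ⟨.node t u, ?_⟩
    have hts : t.size = L.length := by rw [← W1_length t s, ht]
    rw [W1, hts, ← hk, ht, hu]
    simp

lemma W2_surj (n : ℕ) : ∀ l s, l.length ≤ n → Lists l s (s + l.length) → L132 l →
    ∃ t, W2 t s = l := by
  induction n with
  | zero =>
    intro l s hn _ _
    exact ⟨.nil, by rw [W2]; exact (List.length_eq_zero_iff.1 (by omega)).symm⟩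
  | succ n ih =>
    intro l s hn hl hav
    by_cases h0 : l = []
    · exact ⟨.nil, by rw [h0]; rfl⟩
    have hpos : 0 < l.length := List.length_pos_iff.2 h0
    obtain ⟨L, R, hLR⟩ := List.append_of_mem ((hl.2 (s + l.length - 1)).2 (by omega))
    generalize hm : s + l.length - 1 = m at hLR
    have hm' : s + l.length = m + 1 := by omega
    rw [hm'] at hl
    subst hLR
    have hnd := hl.1
    have hmem := hl.2
    simp only [List.nodup_append, List.nodup_cons, List.mem_append,
      List.mem_cons, List.length_append, List.length_cons] at hnd hmem hn hm'
    have hL : ∀ x ∈ L, s ≤ x ∧ x < m := fun x hx => by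
      have h1 := (hmem x).1 (by simp [hx])
      have := hnd.2.2 x hx m (by simp)
      omega
    have hR : ∀ x ∈ R, s ≤ x ∧ x < m := fun x hx => by
      have h1 := (hmem x).1 (by simp [hx])
      have : x ≠ m := fun e => hnd.2.1.1 (e ▸ hx)
      omega
    have hRL : ∀ x ∈ L, ∀ y ∈ R, y < x := fun x hx y hy => by
      by_contra hlt
      have : x ≠ y := hnd.2.2 x hx y (by simp [hy])
      refine hav x m y ?_ ⟨by omega, (hR y hy).2⟩
      have h1 : [x].Sublist L := by simpa using hx
      have h2 : [m, y].Sublist (m :: R) := by simpa using hy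
      simpa using h1.append h2
    have hR' : Lists R s (s + R.length) := by
      refine ⟨hnd.2.1.2, ?_⟩
      have key : ∀ x ∈ R, ∀ y, s ≤ y → y ≤ x → y ∈ R := by
        intro x hx y h1 h2
        have := hR x hx
        rcases (hmem y).2 (by omega) with h | h | h
        · have := hRL y h x hx; omega
        · omega
        · exact h
      have hsub : ∀ x ∈ R, x < s + R.length := by
        intro x hx
        have : Finset.Ico s (x + 1) ⊆ R.toFinset := by
          intro y hy
          rw [Finset.mem_Ico] at hy
          rw [List.mem_toFinset]
          exact key x hx y hy.1 (by omega)
        have := Finset.card_le_card this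
        rw [List.toFinset_card_of_nodup hnd.2.1.2, Nat.card_Ico] at this
        have := hR x hx
        omega
      have heq : R.toFinset = Finset.Ico s (s + R.length) := by
        apply Finset.eq_of_subset_of_card_le
        · intro y hy
          rw [List.mem_toFinset] at hy
          rw [Finset.mem_Ico]
          exact ⟨(hR y hy).1, hsub y hy⟩
        · rw [List.toFinset_card_of_nodup hnd.2.1.2, Nat.card_Ico]
          omega
      intro x
      rw [← List.mem_toFinset, heq, Finset.mem_Ico]
    have hL' : Lists L (s + R.length) m := by
      refine ⟨hnd.1, fun x => ⟨fun hx => ⟨?_, (hL x hx).2⟩, fun hx => ?_⟩⟩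
      · by_contra hlt
        have h1 := (hR'.2 x).2 ⟨(hL x hx).1, by omega⟩
        have := hRL x hx x h1
        omega
      · rcases (hmem x).2 (by omega) with h | h | h
        · exact h
        · omega
        · have := (hR'.2 x).1 h
          omega
    obtain ⟨t, ht⟩ := ih L (s + R.length) (by omega) (by convert hL' using 1; omega)
      (fun a b c h => hav a b c (h.trans (by simp)))
    obtain ⟨u, hu⟩ := ih R s (by omega) hR'
      (fun a b c h => hav a b c (h.trans (by
        exact (List.sublist_cons_self m R).trans (List.sublist_append_right _ _))))
    refine ⟨.node t u, ?_⟩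
    have hts : t.size = L.length := by rw [← W2_length t (s + R.length), ht]
    have hus : u.size = R.length := by rw [← W2_length u s, hu]
    rw [W2, hts, hus, ht, hu]
    congr 2
    omega

lemma strad_zero_above (x : ℕ) (l : List ℕ) (h : ∀ y ∈ l, x ≤ y) : strad x l = 0 := by
  induction l with
  | nil => rfl
  | cons a l ih =>
    cases l with
    | nil => rfl
    | cons b l =>
      rw [strad, ih (fun y hy => h y (by simp [hy]))]
      have := h b (by simp)
      rw [if_neg (by omega)]

lemma strad_zero_below (x : ℕ) (l : List ℕ) (h : ∀ y ∈ l, y ≤ x) : strad x l = 0 := by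
  induction l with
  | nil => rfl
  | cons a l ih =>
    cases l with
    | nil => rfl
    | cons b l =>
      rw [strad, ih (fun y hy => h y (by simp [hy]))]
      have := h a (by simp)
      rw [if_neg (by omega)]

lemma strad_app_above (x : ℕ) (l r : List ℕ) (h : ∀ y ∈ r, x ≤ y) :
    strad x (l ++ r) = strad x l := by
  induction l with
  | nil => rw [List.nil_append, strad_zero_above x r h]; rfl
  | cons a l ih =>
    cases l with
    | nil =>
      cases r with
      | nil => rfl
      | cons b r =>
        have := h b (by simp)
        simp only [List.nil_append] at ih
        simp only [List.cons_append, List.nil_append, strad, ih]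
        rw [if_neg (by omega)]
    | cons b l => 
      simp only [List.cons_append, strad] at ih ⊢
      rw [ih]

lemma lD_app_lt (l r : List ℕ) (h : ∀ x ∈ l, ∀ y ∈ r, x < y) : lD (l ++ r) = lD l + lD r := by
  induction l with
  | nil => simp [lD]
  | cons a l ih =>
    have ih := ih (fun x hx => h x (by simp [hx]))
    cases l with
    | nil =>
      cases r with
      | nil => rfl
      | cons b r =>
        have := h a (by simp) b (by simp)
        simp only [List.cons_append, List.nil_append, lD]
        rw [if_neg (by omega)]
    | cons b l =>
      simp only [List.cons_append, lD] at ih ⊢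
      rw [ih, add_assoc]

lemma lP_app_lt (l r : List ℕ) (h : ∀ x ∈ l, ∀ y ∈ r, x < y) : lP (l ++ r) = lP l + lP r := by
  induction l with
  | nil => simp [lP]
  | cons a l ih =>
    rw [List.cons_append, lP, lP, ih (fun x hx => h x (by simp [hx])),
      strad_app_above _ _ _ (fun y hy => (h a (by simp) y hy).le), add_assoc]

lemma lQ_app_lt (l r : List ℕ) (h : ∀ x ∈ l, ∀ y ∈ r, x < y) : lQ (l ++ r) = lQ l + lQ r := by
  rw [lQ, lQ, lQ, lD_app_lt l r h, lP_app_lt l r h]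
  ring

lemma strad_two (x : ℕ) (l : List ℕ) (k' k : ℕ) (hk : k < x) :
    strad x (l ++ [k', k]) = strad x (l ++ [k']) + if x < k' then 1 else 0 := by
  induction l with
  | nil => simp [strad, hk]
  | cons a l ih =>
    cases l with
    | nil => simp [strad, hk]
    | cons b l =>
      simp only [List.cons_append, strad] at ih ⊢
      rw [ih, add_assoc]

lemma lP_two (l : List ℕ) (k' k : ℕ) (hk : ∀ x ∈ l, k < x) :
    lP (l ++ [k', k]) = lP (l ++ [k']) + l.countP (· < k') := by
  induction l with
  | nil => simp [lP, strad]
  | cons a l ih =>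
    rw [List.cons_append, List.cons_append, lP, lP, ih (fun x hx => hk x (by simp [hx])),
      strad_two _ _ _ _ (hk a (by simp)), List.countP_cons]
    simp only [decide_eq_true_eq]
    ring

lemma lD_two (l : List ℕ) (k' k : ℕ) (hk : k < k') :
    lD (l ++ [k', k]) = lD (l ++ [k']) + 1 := by
  induction l with
  | nil => simp [lD, hk]
  | cons a l ih =>
    cases l with
    | nil => simp [lD, hk]
    | cons b l =>
      simp only [List.cons_append, lD] at ih ⊢
      rw [ih, add_assoc]

lemma W1_stat (t : BT) : ∀ s, lQ (W1 t s) = s1 t := by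
  induction t with
  | nil => intro s; rfl
  | node L M ihL ihM =>
    intro s
    have hL := fun x => (W1_lists L s).2 x
    have hM := fun x => (W1_lists M (s + L.size + 1)).2 x
    rw [W1, lQ_app_lt, ihL, s1, add_assoc (s1 L)]
    · congr 1
      rw [← ihM (s + L.size + 1)]
      cases M with
      | nil => rfl
      | node A B =>
        have hA := W1_lists A (s + L.size + 1)
        have hB := W1_lists B (s + L.size + 1 + A.size + 1)
        rw [W1]
        generalize hk' : s + L.size + 1 + A.size = k' at *
        generalize hk : s + L.size = k at *
        have e : W1 A (k + 1) ++ (W1 B (k' + 1) ++ [k']) ++ [k] =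
          (W1 A (k + 1) ++ W1 B (k' + 1)) ++ [k', k] := by simp
        rw [e, ← List.append_assoc, lQ, lQ, lP_two, lD_two _ _ _ (by omega), List.countP_append,
          List.countP_eq_length.2, List.countP_eq_zero.2, W1_length, pen, lsize]
        · ring
        · intro x hx
          have := (hB.2 x).1 hx
          simp
          omega
        · intro x hx
          have := (hA.2 x).1 hx
          simp
          omega
        · intro x hx
          rw [List.mem_append, hA.2, hB.2] at hx
          omega
    · intro x hx y hy
      rw [List.mem_append, hM, List.mem_singleton] at hy
      rw [hL] at hx
      omega

lemma strad_peak (x m r : ℕ) (l R : List ℕ) (hm : x < m) (hR : ∀ y ∈ r :: R, y < x) :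
    strad x (l ++ m :: r :: R) = strad x l + 1 := by
  induction l with
  | nil =>
    have h := hR r (by simp)
    rw [List.nil_append, strad_cons2, strad_zero_below _ _ (fun y hy => (hR y hy).le), if_pos ⟨h, hm⟩]
    rfl
  | cons a l ih =>
    cases l with
    | nil =>
      simp only [List.nil_append] at ih
      simp only [List.cons_append, List.nil_append]
      rw [strad_cons2, ih, if_neg (by omega)]
      simp [strad]
    | cons b l =>
      simp only [List.cons_append, strad] at ih ⊢
      rw [ih]
      ring

lemma lP_peak (m r : ℕ) (l R : List ℕ) (hm : ∀ x ∈ l, x < m) (hmR : ∀ y ∈ r :: R, y < m)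
    (hR : ∀ x ∈ l, ∀ y ∈ r :: R, y < x) :
    lP (l ++ m :: r :: R) = lP l + lP (r :: R) + l.length := by
  induction l with
  | nil =>
    rw [List.nil_append, lP_cons, strad_zero_below _ _ (fun y hy => (hmR y hy).le)]
    simp [lP]
  | cons a l ih =>
    rw [List.cons_append, lP, lP, ih (fun x hx => hm x (by simp [hx]))
      (fun x hx => hR x (by simp [hx])), strad_peak _ _ _ _ _ (hm a (by simp)) (hR a (by simp)),
      List.length_cons]
    ring

lemma W2_stat (t : BT) : ∀ s, lQ (W2 t s) = s2 t := by
  induction t with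
  | nil => intro s; rfl
  | node L M ihL ihM =>
    intro s
    have hL := fun x => (W2_lists L (s + M.size)).2 x
    have hM := fun x => (W2_lists M s).2 x
    have hlen := W2_length M s
    have hlenL := W2_length L (s + M.size)
    have h1 := ihL (s + M.size)
    have h2 := ihM s
    rw [W2, s2, ← h1, ← h2]
    have e : ∀ x ∈ W2 L (s + M.size), x < s + L.size + M.size := by
      intro x hx
      rw [hL] at hx
      omega
    cases M with
    | nil =>
      rw [lQ_app_lt]
      · simp [W2, lQ, lD, lP, pen, strad]
      · simpa [W2, BT.size] using e
    | node A B =>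
      generalize hm : s + L.size + (A.node B).size = m at *
      cases hr : W2 (A.node B) s with
      | nil => rw [hr] at hlen; simp [BT.size] at hlen
      | cons r R =>
        rw [hr] at hM
        have hmR : ∀ y ∈ r :: R, y < m := by
          intro y hy
          rw [hM] at hy
          omega
        have hD : lD (W2 L (s + (A.node B).size) ++ m :: r :: R) =
            lD (W2 L (s + (A.node B).size)) + lD (r :: R) + 1 := by
          have e1 : W2 L (s + (A.node B).size) ++ m :: r :: R =
            (W2 L (s + (A.node B).size) ++ [m]) ++ (r :: R) := by simp
          have hrm := hmR r (by simp)
          have e2 : ∀ l : List ℕ, (∀ x ∈ l, x < m) → lD (l ++ m :: r :: R) = lD l + lD (m :: r :: R) := by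
            intro l hl
            induction l with
            | nil => simp [lD]
            | cons a l ih =>
              have ih := ih (fun x hx => hl x (by simp [hx]))
              cases l with
              | nil =>
                have := hl a (by simp)
                simp only [List.cons_append, List.nil_append]
                rw [lD_cons2, if_neg (by omega)]
                simp [lD]
              | cons b l =>
                simp only [List.cons_append] at ih ⊢
                rw [lD_cons2, ih, lD_cons2 a, add_assoc]
          rw [e2 _ e, lD_cons2, if_pos hrm]
          ring
        rw [lQ, hD, lP_peak _ _ _ _ e hmR, hlenL, lQ, lQ, pen]
        · ring
        · intro x hx y hy
          rw [hM] at hy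
          rw [hL] at hx
          omega

/-- `mad` over `S_n(312)` is equidistributed with `(1-32)+2·(2-31)+des`
over `S_n(132)`. -/
theorem stmt17 (n : ℕ) (hn : 1 ≤ n) (k : ℕ) :
    Set.ncard {σ : Equiv.Perm (Fin n) | Av312 n (pf σ) ∧ mad n (pf σ) = k} =
    Set.ncard {σ : Equiv.Perm (Fin n) | Av132 n (pf σ) ∧ foze7 n (pf σ) = k} := by
  have i1 : Set.image toL {σ : Equiv.Perm (Fin n) | Av312 n (pf σ) ∧ mad n (pf σ) = k} =
      Set.image (fun t => W1 t 1) {t : BT | t.size = n ∧ s1 t = k} := by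
    ext l
    constructor
    · rintro ⟨σ, ⟨h1, h2⟩, rfl⟩
      have hl := toL_length σ
      rw [pf_eq] at h1 h2
      replace h1 : Av312 (toL σ).length (lf (toL σ)) := by rw [hl]; exact h1
      have h3 := mad_eq _ h1
      rw [hl, h2] at h3
      obtain ⟨t, ht⟩ := W1_surj n (toL σ) 1 hl.le
        (by rw [hl, add_comm]; exact toL_lists σ) ((L312_iff _).1 h1)
      exact ⟨t, ⟨by rw [← W1_length t 1, ht, hl], by rw [← W1_stat t 1, ht, h3]⟩, ht⟩
    · rintro ⟨t, ⟨h1, h2⟩, rfl⟩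
      obtain ⟨σ, hσ⟩ := toL_surj (n := n) (W1 t 1) (by
        have := W1_lists t 1
        rwa [h1, add_comm] at this)
      have hl := toL_length σ
      have hav : Av312 (toL σ).length (lf (toL σ)) := by
        rw [L312_iff, hσ]; exact W1_av t 1
      have h3 := mad_eq _ hav
      rw [hl] at hav h3
      refine ⟨σ, ⟨by rw [pf_eq]; exact hav, by rw [pf_eq, h3, hσ, W1_stat, h2]⟩, hσ⟩
  have i2 : Set.image toL {σ : Equiv.Perm (Fin n) | Av132 n (pf σ) ∧ foze7 n (pf σ) = k} =
      Set.image (fun t => W2 t 1) {t : BT | t.size = n ∧ s2 t = k} := by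
    ext l
    constructor
    · rintro ⟨σ, ⟨h1, h2⟩, rfl⟩
      have hl := toL_length σ
      rw [pf_eq] at h1 h2
      replace h1 : Av132 (toL σ).length (lf (toL σ)) := by rw [hl]; exact h1
      have h3 := foze7_eq _ h1
      rw [hl, h2] at h3
      obtain ⟨t, ht⟩ := W2_surj n (toL σ) 1 hl.le
        (by rw [hl, add_comm]; exact toL_lists σ) ((L132_iff _).1 h1)
      exact ⟨t, ⟨by rw [← W2_length t 1, ht, hl], by rw [← W2_stat t 1, ht, h3]⟩, ht⟩
    · rintro ⟨t, ⟨h1, h2⟩, rfl⟩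
      obtain ⟨σ, hσ⟩ := toL_surj (n := n) (W2 t 1) (by
        have := W2_lists t 1
        rwa [h1, add_comm] at this)
      have hl := toL_length σ
      have hav : Av132 (toL σ).length (lf (toL σ)) := by
        rw [L132_iff, hσ]; exact W2_av t 1
      have h3 := foze7_eq _ hav
      rw [hl] at hav h3
      refine ⟨σ, ⟨by rw [pf_eq]; exact hav, by rw [pf_eq, h3, hσ, W2_stat, h2]⟩, hσ⟩
  have i3 : Set.image psi {t : BT | t.size = n ∧ s2 t = k} = {t : BT | t.size = n ∧ s1 t = k} := by
    ext t
    constructor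
    · rintro ⟨u, ⟨h1, h2⟩, rfl⟩
      exact ⟨by rw [psi_size, h1], by rw [psi_s, h2]⟩
    · rintro ⟨h1, h2⟩
      obtain ⟨u, rfl⟩ := psi_surj _ t le_rfl
      exact ⟨u, ⟨by rw [← psi_size, h1], by rw [← psi_s, h2]⟩, rfl⟩
  rw [← Set.ncard_image_of_injective _ (toL_inj (n := n)), i1,
    Set.ncard_image_of_injective _ (fun a b h => W1_inj a 1 b h), ← i3,
    Set.ncard_image_of_injective _ psi_inj,
    ← Set.ncard_image_of_injective _ (toL_inj (n := n)), i2,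
    Set.ncard_image_of_injective _ (fun a b h => W2_inj a 1 b h)]

end MahonianStats
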